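/- arXiv:2305.06285 — 2 statements merged into one kernel-verified Lean document; each statement's English description precedes it below -/
import Mathlib

section
/- Let μ be a weighted m-ovoid of the polar space P'_{r,e}, and let p₀ be a point of P'_{r,e} with μ(p₀) < m. Then m·(q^{r+e−3}+1)·(m·(q^{r+e−1}+1) − μ(p₀)) + q^{r+e−2}·Σ_{p ∈ p₀^⊥∖{p₀}} μ(p)² = m·(q^{r+e−2}+1)²·(m − μ(p₀)) + q^{r+e−3}·Σ_{p ∈ P'_{r,e}∖{p₀}} μ(p)·μ(⟨p₀,p⟩), where the first sum is over the points of PG(n,q) in p₀^⊥ other than p₀, the second sum is over the points of P'_{r,e} other than p₀, and ⟨p₀,p⟩ denotes the projective line through p₀ and p. -/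
noncomputable section

open scoped BigOperators

namespace PolarOvoids

/-- The kind of the polar space `P'_{r,e}`: the elliptic quadric `Q⁻(2r+1,q)` (`e = 2`),
the symplectic polar space `W(2r-1,q)` (`e = 1`), or the Hermitian polar space `H(2r,q)`
with `q` a square (`e = 3/2`). -/
inductive PolarKind : Type where
  | elliptic
  | symplectic
  | hermitian

/-- The parameter `e` of the polar space. -/
def PolarKind.e : PolarKind → ℝ
  | .elliptic => 2
  | .symplectic => 1
  | .hermitian => 3 / 2

/-- The dimension `2r + 2e - 2` of the vector space underlying the ambient projective
space `PG(n,q)`, `n = 2r + 2e - 3`. -/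
def PolarKind.vdim : PolarKind → ℕ → ℕ
  | .elliptic, r => 2 * r + 2
  | .symplectic, r => 2 * r
  | .hermitian, r => 2 * r + 1

/-- The orthogonal complement (polar image) of a subspace with respect to a
(reflexive) sesquilinear form `B`. -/
def sperp {F V : Type} [Field F] [AddCommGroup V] [Module F V] {σ : F →+* F}
    (B : V →ₗ[F] V →ₛₗ[σ] F) (W : Submodule F V) : Submodule F V where
  carrier := {v | ∀ w ∈ W, B w v = 0}
  add_mem' := by
    intro a b ha hb w hw
    simp only [map_add, ha w hw, hb w hw, add_zero]
  zero_mem' := by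
    intro w hw
    simp
  smul_mem' := by
    intro c v hv w hw
    simp only [map_smulₛₗ, hv w hw, smul_zero]

/-- The set of points of the projective space `PG(n,q)` lying in a projective subspace,
given as the corresponding linear subspace `W`. -/
def pts {F V : Type} [Field F] [AddCommGroup V] [Module F V] (W : Submodule F V) :
    Set (Projectivization F V) := {p | p.rep ∈ W}

/-- The total weight `μ(S) = ∑_{p ∈ S} μ(p)` of a set `S` of projective points under a
weight function `μ` on the points. -/
def wsum {F V : Type} [Field F] [AddCommGroup V] [Module F V]
    (μ : Projectivization F V → ℕ) (S : Set (Projectivization F V)) : ℝ :=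
  ∑ᶠ p ∈ S, (μ p : ℝ)

/-- The weight `μ(S) = |S ∩ O|` of a point set `S` with respect to the point set `O`. -/
def nwt {X : Type} (O S : Set X) : ℝ := ((S ∩ O).ncard : ℝ)

/-- The defining property of each kind of polar space, in terms of the companion
automorphism `σ`, the sesquilinear form `B` inducing the polarity, the point set `sing`
of the polar space and the predicate `ti` of total isotropy (resp. total singularity):
* symplectic: `B` is a non-degenerate alternating bilinear form;
* Hermitian: `B` is a non-degenerate Hermitian form with respect to the involutory field
  automorphism `σ` (so the field order is a square `q` and `σ : x ↦ x^√q`);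
* elliptic: `B` is the bilinear form associated to a non-singular quadratic form `Q`,
  of Witt index `r` (imposed by the rank axioms below). -/
def PolarKind.Spec {F : Type} [Field F] {N : ℕ} :
    (k : PolarKind) → (σ : F →+* F) →
    ((Fin N → F) →ₗ[F] (Fin N → F) →ₛₗ[σ] F) →
    Set (Projectivization F (Fin N → F)) →
    (Submodule F (Fin N → F) → Prop) → Prop
  | .symplectic, σ, B, sing, ti =>
      σ = RingHom.id F ∧ (∀ v, B v v = 0) ∧ sing = Set.univ ∧
        ∀ W, ti W ↔ ∀ v ∈ W, ∀ w ∈ W, B v w = 0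
  | .hermitian, σ, B, sing, ti =>
      σ ≠ RingHom.id F ∧ σ.comp σ = RingHom.id F ∧
        (∀ v w, B w v = σ (B v w)) ∧
        sing = {p | B p.rep p.rep = 0} ∧
        ∀ W, ti W ↔ ∀ v ∈ W, ∀ w ∈ W, B v w = 0
  | .elliptic, σ, B, sing, ti =>
      σ = RingHom.id F ∧
        ∃ Q : QuadraticForm F (Fin N → F),
          (∀ v w, QuadraticMap.polar (⇑Q) v w = B v w) ∧
          sing = {p | Q p.rep = 0} ∧
          ∀ W, ti W ↔ ∀ v ∈ W, Q v = 0

/-- A finite classical polar space `P'_{r,e}` of rank `r` and kind `k` over the finite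
field `F` (of order `q`), consisting of the totally isotropic (resp. totally singular)
subspaces with respect to the defining form.  Its ambient projective space is
`PG(2r + 2e - 3, q)`, whose points are the points of `Projectivization F (Fin (k.vdim r) → F)`
and whose `j`-dimensional projective subspaces correspond to the linear subspaces
`W : Submodule F (Fin (k.vdim r) → F)` with `Module.finrank F W = j + 1`.
The polarity `⊥` of the ambient projective space is induced by the non-degenerate
reflexive (sesquilinear) form `B`; the rank axioms state that the Witt index is `r`,
i.e. generators have projective dimension `r - 1`. -/
structure PolarSpace (F : Type) [Field F] (r : ℕ) (k : PolarKind) where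
  σ : F →+* F
  B : (Fin (k.vdim r) → F) →ₗ[F] (Fin (k.vdim r) → F) →ₛₗ[σ] F
  nondeg : ∀ v, (∀ w, B v w = 0) → v = 0
  sing : Set (Projectivization F (Fin (k.vdim r) → F))
  ti : Submodule F (Fin (k.vdim r) → F) → Prop
  spec : k.Spec σ B sing ti
  rank_exists : ∃ W, ti W ∧ Module.finrank F ↥W = r
  rank_le : ∀ W, ti W → Module.finrank F ↥W ≤ r

namespace PolarSpace

variable {F : Type} [Field F] {r : ℕ} {k : PolarKind}

/-- The image `π^⊥` of a subspace `π` under the polarity of the ambient projective space. -/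
def perp (P : PolarSpace F r k) (W : Submodule F (Fin (k.vdim r) → F)) :
    Submodule F (Fin (k.vdim r) → F) := sperp P.B W

/-- The image `p^⊥` of a point `p` under the polarity of the ambient projective space. -/
def pperp (P : PolarSpace F r k) (p : Projectivization F (Fin (k.vdim r) → F)) :
    Submodule F (Fin (k.vdim r) → F) := sperp P.B (Submodule.span F {p.rep})

/-- A generator: a maximal totally isotropic (totally singular) subspace, i.e. one of
projective dimension `r - 1`. -/
def IsGenerator (P : PolarSpace F r k) (W : Submodule F (Fin (k.vdim r) → F)) : Prop :=
  P.ti W ∧ Module.finrank F ↥W = r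

/-- An `m`-ovoid: a set `O` of points of the polar space such that every generator
contains exactly `m` points of `O`. -/
def IsMOvoid (P : PolarSpace F r k) (m : ℕ)
    (O : Set (Projectivization F (Fin (k.vdim r) → F))) : Prop :=
  O ⊆ P.sing ∧ ∀ W, P.IsGenerator W → (pts W ∩ O).ncard = m

/-- A non-trivial `m`-ovoid: an `m`-ovoid with `0 < m < θ_{r-1} = (q^r - 1)/(q - 1)`,
the number of points of a generator. -/
def IsNontrivialMOvoid [Fintype F] (P : PolarSpace F r k) (m : ℕ)
    (O : Set (Projectivization F (Fin (k.vdim r) → F))) : Prop :=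
  P.IsMOvoid m O ∧ 0 < m ∧ m < ∑ i ∈ Finset.range r, Fintype.card F ^ i

/-- A weighted `m`-ovoid: a function `μ` assigning a natural number to each point of the
ambient projective space, vanishing on points not in the polar space, such that
`μ(p^⊥) + q^{r+e-2}·μ(p) = m·(q^{r+e-2} + 1)` for every point `p` of `PG(n,q)`. -/
def IsWeightedMOvoid [Fintype F] (P : PolarSpace F r k) (m : ℕ)
    (μ : Projectivization F (Fin (k.vdim r) → F) → ℕ) : Prop :=
  (∀ p, p ∉ P.sing → μ p = 0) ∧
  ∀ p, wsum μ (pts (P.pperp p)) +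
      (Fintype.card F : ℝ) ^ ((r : ℝ) + k.e - 2) * (μ p : ℝ)
    = (m : ℝ) * ((Fintype.card F : ℝ) ^ ((r : ℝ) + k.e - 2) + 1)

end PolarSpace

section Counting

open Classical

variable {F V : Type} [Field F] [AddCommGroup V] [Module F V]

lemma mk_mem_pts {W : Submodule F V} {v : V} (hv : v ≠ 0) :
    Projectivization.mk F v hv ∈ pts W ↔ v ∈ W := by
  obtain ⟨a, ha⟩ := Projectivization.exists_smul_eq_mk_rep F v hv
  change (Projectivization.mk F v hv).rep ∈ W ↔ v ∈ W
  rw [← ha]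
  exact W.smul_mem_iff_of_isUnit a.isUnit

lemma range_map_subtype (W : Submodule F V) :
    Set.range (Projectivization.map W.subtype W.injective_subtype) = pts W := by
  ext p
  constructor
  · rintro ⟨w, rfl⟩
    induction w using Projectivization.ind with
    | h w hw =>
      rw [Projectivization.map_mk, mk_mem_pts]
      exact w.2
  · intro hp
    refine ⟨Projectivization.mk F ⟨p.rep, hp⟩ fun h => p.rep_nonzero (congrArg Subtype.val h), ?_⟩
    rw [Projectivization.map_mk]
    exact p.mk_rep

lemma natCard_pts (W : Submodule F V) : Nat.card (pts W) = Nat.card (Projectivization F W) := by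
  rw [← range_map_subtype]
  exact (Nat.card_congr (Equiv.ofInjective _
    (Projectivization.map_injective (τ := RingHom.id F) _ W.injective_subtype))).symm

variable [Fintype F] [Fintype (Projectivization F V)]

lemma sum_mem_mul_card_sub_one [FiniteDimensional F V] (W : Submodule F V) :
    (∑ p : Projectivization F V, if p.rep ∈ W then (1 : ℝ) else 0) * ((Fintype.card F : ℝ) - 1) + 1
      = (Fintype.card F : ℝ) ^ Module.finrank F W := by
  have hfin : Finite W := Module.finite_of_finite F
  have h := Projectivization.card' F W
  rw [Module.natCard_eq_pow_finrank (K := F), ← natCard_pts, Nat.card_eq_fintype_card (α := F)] at h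
  have hq : 1 ≤ Fintype.card F := Fintype.card_pos
  have hc : (∑ p : Projectivization F V, if p.rep ∈ W then (1 : ℝ) else 0)
      = (Nat.card (pts W) : ℝ) := by
    rw [Finset.sum_boole, Nat.card_eq_card_toFinset]
    congr 2
    ext p
    rw [Set.mem_toFinset, Finset.mem_filter_univ]
    rfl
  rw [hc, ← Nat.cast_pow, h]
  push_cast [hq]
  ring

lemma sum_mem_ker_mul_card_sub_one [FiniteDimensional F V] (W : Submodule F V) (f : V →ₗ[F] F)
    (hf : ∃ v ∈ W, f v ≠ 0) :
    ((∑ p : Projectivization F V, if p.rep ∈ W ∧ f p.rep = 0 then (1 : ℝ) else 0) *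
      ((Fintype.card F : ℝ) - 1) + 1) * Fintype.card F
      = (Fintype.card F : ℝ) ^ Module.finrank F W := by
  have h0 : f.domRestrict W ≠ 0 := by
    obtain ⟨v, hv, hfv⟩ := hf
    exact fun h => hfv (LinearMap.congr_fun h ⟨v, hv⟩)
  have h := sum_mem_mul_card_sub_one ((LinearMap.ker (f.domRestrict W)).map W.subtype)
  rw [Submodule.finrank_map_subtype_eq] at h
  rw [← Module.Dual.finrank_ker_add_one_of_ne_zero h0, pow_succ, ← h]
  simp [and_comm]

variable [FiniteDimensional F V]

/-- The number of points `x` on a line that are perpendicular to `y`. -/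
lemma sum_line_perp (p p' : Projectivization F V) (hne : p ≠ p') (f : V →ₗ[F] F) :
    (∑ x : Projectivization F V,
      if x.rep ∈ Submodule.span F {p.rep} ⊔ Submodule.span F {p'.rep} ∧ f x.rep = 0
        then (1 : ℝ) else 0)
      = 1 + Fintype.card F * if f p.rep = 0 ∧ f p'.rep = 0 then 1 else 0 := by
  have hq : (1 : ℝ) < Fintype.card F := by exact_mod_cast Fintype.one_lt_card
  set L := Submodule.span F {p.rep} ⊔ Submodule.span F {p'.rep} with hL
  have hfr : Module.finrank F L = 2 := by
    have hli := Projectivization.linearIndependent_pair_iff_ne.2 hne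
    rw [hL, ← Submodule.span_union, Set.singleton_union, ← Matrix.range_cons_cons_empty,
      finrank_span_eq_card hli, Fintype.card_fin]
  have hp : p.rep ∈ L := Submodule.mem_sup_left (Submodule.mem_span_singleton_self _)
  have hp' : p'.rep ∈ L := Submodule.mem_sup_right (Submodule.mem_span_singleton_self _)
  split_ifs with h
  · have hker : L ≤ LinearMap.ker f := by
      rw [hL, sup_le_iff, Submodule.span_singleton_le_iff_mem, Submodule.span_singleton_le_iff_mem]
      exact h
    have hc := sum_mem_mul_card_sub_one L
    rw [hfr] at hc
    have he : ∀ x : Projectivization F V, (x.rep ∈ L ∧ f x.rep = 0) ↔ x.rep ∈ L :=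
      fun x => and_iff_left_of_imp fun hx => hker hx
    simp only [he]
    apply mul_right_cancel₀ (sub_pos.2 hq).ne'
    linear_combination hc
  · have hc := sum_mem_ker_mul_card_sub_one L f (by
      by_contra! hcon
      exact h ⟨hcon _ hp, hcon _ hp'⟩)
    rw [hfr] at hc
    apply mul_right_cancel₀ (sub_pos.2 hq).ne'
    apply mul_right_cancel₀ (zero_lt_one.trans hq).ne'
    linear_combination hc

lemma finsum_mem_eq_sum_ite {X : Type} [Fintype X] (S : Set X) (f : X → ℝ) :
    ∑ᶠ x ∈ S, f x = ∑ x, if x ∈ S then f x else 0 := by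
  rw [finsum_mem_def, finsum_eq_sum_of_fintype]
  exact Finset.sum_congr rfl fun x _ => Set.indicator_apply S f x

end Counting

/-- The double counting identity for an abstract symmetric `0`-`1` incidence matrix `χ`
(perpendicularity) and a family `ℓ` of point sets (the lines through `p₀`). -/
lemma sum_identity_of_incidence {X : Type} [Fintype X] [DecidableEq X] (χ ℓ : X → X → ℝ) (μ : X → ℝ)
    (p₀ : X) (q a b m : ℝ) (hq : 1 < q) (ha : 0 < a) (haq : a * q ≠ 1) (hb : b * q = a)
    (hsymm : ∀ x y, χ x y = χ y x) (hself : χ p₀ p₀ = 1) (hidem : ∀ x, χ p₀ x * χ p₀ x = χ p₀ x)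
    (hX : (Fintype.card X : ℝ) * (q - 1) + 1 = (a * q) ^ 2)
    (hperp : ∀ y, ((∑ x, χ x y) * (q - 1) + 1) * q = (a * q) ^ 2)
    (hline : ∀ p, p ≠ p₀ → ∑ x, ℓ p x = 1 + q)
    (hline_perp : ∀ p, p ≠ p₀ → ∀ y, ∑ x, ℓ p x * χ x y = 1 + q * (χ p₀ y * χ p y))
    (hμ : ∀ x, ∑ y, χ x y * μ y + a * μ x = m * (a + 1)) :
    m * (b + 1) * (m * (a * q + 1) - μ p₀) + a * ∑ p ∈ Finset.univ.erase p₀, χ p₀ p * μ p ^ 2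
      = m * (a + 1) ^ 2 * (m - μ p₀) +
        b * ∑ p ∈ Finset.univ.erase p₀, μ p * ∑ x, ℓ p x * μ x := by
  have hq0 : q ≠ 0 := by positivity
  have hq1 : q - 1 ≠ 0 := (sub_pos.2 hq).ne'
  have htotal : ∑ x, μ x = m * (a * q + 1) := by
    have h1 : ∑ x, (∑ y, χ x y * μ y + a * μ x) = Fintype.card X * (m * (a + 1)) := by
      simp [hμ]
    have h2 : ∀ y, ∑ x, χ x y * μ y * (q * (q - 1)) = (a ^ 2 * q ^ 2 - q) * μ y := fun y => by
      rw [← Finset.sum_mul, ← Finset.sum_mul]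
      linear_combination μ y * hperp y
    have h3 : (∑ x, ∑ y, χ x y * μ y) * (q * (q - 1)) = (a ^ 2 * q ^ 2 - q) * ∑ x, μ x := by
      rw [Finset.sum_comm, Finset.sum_mul, Finset.mul_sum]
      exact Finset.sum_congr rfl fun y _ => by rw [Finset.sum_mul, h2]
    rw [Finset.sum_add_distrib, ← Finset.mul_sum] at h1
    have hne : q * (a * q - 1) * (a + 1) ≠ 0 :=
      mul_ne_zero (mul_ne_zero hq0 (sub_ne_zero.2 haq)) (by positivity)
    apply mul_left_cancel₀ hne
    linear_combination q * (q - 1) * h1 - h3 + q * m * (a + 1) * hX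
  have hperp_line : ∀ p, p ≠ p₀ →
      ∑ y, χ p₀ y * χ p y * μ y = m * (b + 1) - b * ∑ x, ℓ p x * μ x := fun p hp => by
    have h1 : ∑ x, ℓ p x * (∑ y, χ x y * μ y + a * μ x) = (1 + q) * (m * (a + 1)) := by
      simp only [hμ, ← Finset.sum_mul, hline p hp]
    have h2 : ∑ x, ℓ p x * ∑ y, χ x y * μ y
        = ∑ x, μ x + q * ∑ y, χ p₀ y * χ p y * μ y := by
      simp only [Finset.mul_sum]
      rw [Finset.sum_comm, ← Finset.sum_add_distrib]
      refine Finset.sum_congr rfl fun y _ => ?_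
      simp only [← mul_assoc]
      rw [← Finset.sum_mul, hline_perp p hp]
      ring
    have h3 : ∑ x, ℓ p x * (a * μ x) = a * ∑ x, ℓ p x * μ x := by
      rw [Finset.mul_sum]
      exact Finset.sum_congr rfl fun x _ => by ring
    simp only [mul_add, Finset.sum_add_distrib] at h1
    apply mul_left_cancel₀ hq0
    rw [h2, h3, htotal] at h1
    linear_combination h1 + (∑ x, ℓ p x * μ x - m) * hb
  have hpairs : ∑ p, μ p * ∑ y, χ p₀ y * χ p y * μ y
      = m * (a + 1) * ∑ x, χ p₀ x * μ x - a * ∑ x, χ p₀ x * μ x ^ 2 := by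
    simp only [Finset.mul_sum]
    rw [Finset.sum_comm, ← Finset.sum_sub_distrib]
    refine Finset.sum_congr rfl fun y _ => ?_
    have h : ∑ x, μ x * (χ p₀ y * χ x y * μ y) = χ p₀ y * μ y * ∑ x, χ y x * μ x := by
      rw [Finset.mul_sum]
      exact Finset.sum_congr rfl fun x _ => by rw [hsymm x y]; ring
    rw [h]
    linear_combination χ p₀ y * μ y * hμ y
  have hrest : ∑ p ∈ Finset.univ.erase p₀, μ p * ∑ y, χ p₀ y * χ p y * μ y
      = m * (b + 1) * ∑ p ∈ Finset.univ.erase p₀, μ p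
        - b * ∑ p ∈ Finset.univ.erase p₀, μ p * ∑ x, ℓ p x * μ x := by
    rw [Finset.mul_sum, Finset.mul_sum, ← Finset.sum_sub_distrib]
    refine Finset.sum_congr rfl fun p hp => ?_
    rw [hperp_line p (Finset.ne_of_mem_erase hp)]
    ring
  have hμ₀ := hμ p₀
  have hdiag : ∑ y, χ p₀ y * χ p₀ y * μ y = ∑ y, χ p₀ y * μ y := by simp only [hidem]
  rw [← Finset.add_sum_erase _ _ (Finset.mem_univ p₀)] at htotal
  rw [← Finset.add_sum_erase _ _ (Finset.mem_univ p₀), hdiag, hrest,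
    ← Finset.add_sum_erase _ (fun x => χ p₀ x * μ x ^ 2) (Finset.mem_univ p₀), hself] at hpairs
  linear_combination hpairs - m * (b + 1) * htotal + (m * (a + 1) - μ p₀) * hμ₀

namespace PolarSpace

variable {F : Type} [Field F] {r : ℕ} {k : PolarKind}

lemma B_eq_zero_comm (P : PolarSpace F r k) (v w : Fin (k.vdim r) → F) :
    P.B v w = 0 ↔ P.B w v = 0 := by
  obtain ⟨σ, B, -, sing, ti, spec, -, -⟩ := P
  cases k with
  | symplectic =>
    obtain ⟨rfl, halt, -⟩ := spec
    have h := halt (v + w)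
    simp only [map_add, LinearMap.add_apply, halt, zero_add, add_zero] at h
    rw [eq_neg_of_add_eq_zero_left h, neg_eq_zero]
  | hermitian =>
    obtain ⟨-, -, hherm, -⟩ := spec
    change B v w = 0 ↔ B w v = 0
    rw [hherm v w, map_eq_zero σ]
  | elliptic =>
    obtain ⟨rfl, Q, hQ, -⟩ := spec
    rw [← hQ, ← hQ, QuadraticMap.polar_comm]

lemma B_self_eq_zero (P : PolarSpace F r k) {p : Projectivization F (Fin (k.vdim r) → F)}
    (hp : p ∈ P.sing) : P.B p.rep p.rep = 0 := by
  revert hp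
  obtain ⟨σ, B, -, sing, ti, spec, -, -⟩ := P
  cases k with
  | symplectic => exact fun _ => spec.2.1 _
  | hermitian =>
    obtain ⟨-, -, -, rfl, -⟩ := spec
    exact id
  | elliptic =>
    obtain ⟨rfl, Q, hQ, rfl, -⟩ := spec
    intro hp
    rw [← hQ, QuadraticMap.polar_self, show Q p.rep = 0 from hp, smul_zero]

lemma mem_pts_pperp (P : PolarSpace F r k) (p x : Projectivization F (Fin (k.vdim r) → F)) :
    x ∈ pts (P.pperp p) ↔ P.B p.rep x.rep = 0 := by
  constructor
  · intro h
    exact h _ (Submodule.mem_span_singleton_self _)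
  · intro h w hw
    obtain ⟨c, rfl⟩ := Submodule.mem_span_singleton.1 hw
    rw [map_smul, LinearMap.smul_apply, h, smul_zero]

end PolarSpace

lemma PolarKind.vdim_eq (k : PolarKind) (r : ℕ) : (k.vdim r : ℝ) = (r + k.e - 1) * 2 := by
  cases k <;> simp only [vdim, e] <;> push_cast <;> ring

/-- Corollary 3.3: the counting identity for a weighted `m`-ovoid `μ` of
`P'_{r,e}` at a point `p₀` of `P'_{r,e}` with `μ(p₀) < m`. -/
theorem weighted_ovoid_point_identity
    {F : Type} [Field F] [Fintype F] {q r m : ℕ} (hq : Fintype.card F = q)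
    {k : PolarKind} (P : PolarSpace F r k)
    (μ : Projectivization F (Fin (k.vdim r) → F) → ℕ)
    (hμ : P.IsWeightedMOvoid m μ)
    (p₀ : Projectivization F (Fin (k.vdim r) → F)) (hp₀ : p₀ ∈ P.sing)
    (hlt : μ p₀ < m) :
    (m : ℝ) * ((q : ℝ) ^ ((r : ℝ) + k.e - 3) + 1) *
        ((m : ℝ) * ((q : ℝ) ^ ((r : ℝ) + k.e - 1) + 1) - (μ p₀ : ℝ)) +
      (q : ℝ) ^ ((r : ℝ) + k.e - 2) *
        ∑ᶠ p ∈ pts (P.pperp p₀) \ {p₀}, ((μ p : ℝ)) ^ 2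
    = (m : ℝ) * ((q : ℝ) ^ ((r : ℝ) + k.e - 2) + 1) ^ 2 * ((m : ℝ) - (μ p₀ : ℝ)) +
      (q : ℝ) ^ ((r : ℝ) + k.e - 3) *
        ∑ᶠ p ∈ P.sing \ {p₀},
          (μ p : ℝ) *
            wsum μ (pts (Submodule.span F {p₀.rep} ⊔ Submodule.span F {p.rep})) := by
  classical
  subst hq
  set q : ℝ := (Fintype.card F : ℝ) with hq
  have hq1 : 1 < q := by
    rw [hq]
    exact_mod_cast Fintype.one_lt_card
  have hq0 : 0 < q := zero_lt_one.trans hq1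
  have hfin : Fintype (Projectivization F (Fin (k.vdim r) → F)) := Fintype.ofFinite _
  have haq : q ^ ((r : ℝ) + k.e - 2) * q = q ^ ((r : ℝ) + k.e - 1) := by
    rw [← Real.rpow_add_one hq0.ne']
    ring_nf
  have hbq : q ^ ((r : ℝ) + k.e - 3) * q = q ^ ((r : ℝ) + k.e - 2) := by
    rw [← Real.rpow_add_one hq0.ne']
    ring_nf
  have hsq : (q ^ ((r : ℝ) + k.e - 2) * q) ^ 2 = q ^ k.vdim r := by
    rw [haq, ← Real.rpow_natCast, ← Real.rpow_mul hq0.le, ← Real.rpow_natCast, k.vdim_eq]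
    norm_num
  have hne : q ^ ((r : ℝ) + k.e - 2) * q ≠ 1 := by
    intro h
    rw [h, one_pow] at hsq
    have hd : k.vdim r ≠ 0 := by
      intro hd
      apply p₀.rep_nonzero
      ext i
      exact absurd i.2 (by omega)
    exact (one_lt_pow₀ hq1 hd).ne hsq
  have hfr : Module.finrank F (Fin (k.vdim r) → F) = k.vdim r := by simp
  have hline_perp := fun (p : Projectivization F (Fin (k.vdim r) → F)) (hp : p ≠ p₀) f =>
    sum_line_perp p₀ p hp.symm f
  have key := sum_identity_of_incidence
    (fun x y => if P.B x.rep y.rep = 0 then 1 else 0)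
    (fun p x => if x.rep ∈ Submodule.span F {p₀.rep} ⊔ Submodule.span F {p.rep} then 1 else 0)
    (fun p => (μ p : ℝ)) p₀ q _ _ m hq1 (Real.rpow_pos_of_pos hq0 _) hne hbq
    (fun x y => by simp only [P.B_eq_zero_comm x.rep y.rep])
    (by simp [P.B_self_eq_zero hp₀])
    (fun x => by simp)
    (by
      have h := sum_mem_mul_card_sub_one (⊤ : Submodule F (Fin (k.vdim r) → F))
      rw [finrank_top, hfr] at h
      rw [hsq, ← h]
      simp [hq])
    (fun y => by
      obtain ⟨w, hw⟩ : ∃ w, P.B y.rep w ≠ 0 := by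
        by_contra! h
        exact y.rep_nonzero (P.nondeg _ h)
      have h := sum_mem_ker_mul_card_sub_one ⊤ (P.B.flip y.rep)
        ⟨w, Submodule.mem_top, fun h => hw ((P.B_eq_zero_comm _ _).1 h)⟩
      rw [finrank_top, hfr] at h
      rw [hsq, ← h]
      simp [hq])
    (fun p hp => by simpa using hline_perp p hp 0)
    (fun p hp y => by
      have h := hline_perp p hp (P.B.flip y.rep)
      simp only [LinearMap.flip_apply] at h
      simp only [ite_zero_mul_ite_zero, mul_one]
      convert h <;> exact if_congr Iff.rfl rfl rfl)
    (fun x => by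
      rw [← hμ.2 x, wsum, finsum_mem_eq_sum_ite]
      simp [P.mem_pts_pperp, hq])
  have hT : ∑ᶠ p ∈ pts (P.pperp p₀) \ {p₀}, (μ p : ℝ) ^ 2
      = ∑ p ∈ Finset.univ.erase p₀, (if P.B p₀.rep p.rep = 0 then 1 else 0) * (μ p : ℝ) ^ 2 := by
    rw [finsum_mem_eq_sum_ite, ← Finset.filter_ne', Finset.sum_filter]
    refine Finset.sum_congr rfl fun p _ => ?_
    by_cases hp : p = p₀ <;> simp [P.mem_pts_pperp, hp]
  have hS : ∀ f : Projectivization F (Fin (k.vdim r) → F) → ℝ,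
      ∑ᶠ p ∈ P.sing \ {p₀}, (μ p : ℝ) * f p = ∑ p ∈ Finset.univ.erase p₀, (μ p : ℝ) * f p := by
    intro f
    rw [finsum_mem_eq_sum_ite, ← Finset.filter_ne', Finset.sum_filter]
    refine Finset.sum_congr rfl fun p _ => ?_
    by_cases hs : p ∈ P.sing
    · simp [hs]
    · simp [hs, hμ.1 p hs]
  have hL : ∀ W : Submodule F (Fin (k.vdim r) → F),
      wsum μ (pts W) = ∑ x, (if x.rep ∈ W then 1 else 0) * (μ x : ℝ) := by
    intro W
    rw [wsum, finsum_mem_eq_sum_ite]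
    refine Finset.sum_congr rfl fun x _ => ?_
    rw [ite_mul, one_mul, zero_mul]
    rfl
  rw [hT, hS, ← haq]
  simp only [hL]
  exact key


end PolarOvoids
end
end

section
/- Let O be a non-trivial m-ovoid of the polar space P'_{r,e} with weight function μ, and let p₀ be a point of P'_{r,e}. Then Σ_{p ∈ p₀^⊥∖{p₀}} μ(p)² = (m − μ(p₀))·(q^{r+e−2} + 1), where the sum is over the points of PG(n,q) in p₀^⊥ other than p₀. -/
noncomputable section

open scoped BigOperators

namespace PolarOvoids

section Counting

open Finset Module

open scoped Classical in
/-- The number of vectors of a subspace of a finite vector space. -/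
theorem card_filter_mem {F V : Type} [Field F] [Fintype F] [AddCommGroup V] [Module F V]
    [Fintype V] (W : Submodule F V) :
    (#{v | v ∈ W} : ℕ) = Fintype.card F ^ finrank F W := by
  rw [← card_eq_pow_finrank (K := F) (V := W), Fintype.card_subtype]

variable {F V : Type} [Field F] [AddCommGroup V] [Module F V] {σ : F →+* F}
  {B : V →ₗ[F] V →ₛₗ[σ] F} {W U : Submodule F V} {u v : V}

theorem mem_sperp : v ∈ sperp B W ↔ ∀ w ∈ W, B w v = 0 := Iff.rfl

theorem mem_sup_span : v ∈ W ⊔ F ∙ u ↔ ∃ w ∈ W, ∃ a : F, w + a • u = v := by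
  simp [Submodule.mem_sup, Submodule.mem_span_singleton]

theorem sperp_sup : sperp B (W ⊔ U) = sperp B W ⊓ sperp B U := by
  ext v
  simp only [Submodule.mem_inf, mem_sperp]
  refine ⟨fun h => ⟨fun w hw => h w (Submodule.mem_sup_left hw),
    fun w hw => h w (Submodule.mem_sup_right hw)⟩, ?_⟩
  rintro ⟨h₁, h₂⟩ x hx
  obtain ⟨w, hw, t, ht, rfl⟩ := Submodule.mem_sup.1 hx
  simp [h₁ w hw, h₂ t ht]

theorem mem_sperp_span_singleton : v ∈ sperp B (F ∙ u) ↔ B u v = 0 := by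
  refine ⟨fun h => h u (Submodule.mem_span_singleton_self u), fun h w hw => ?_⟩
  obtain ⟨a, rfl⟩ := Submodule.mem_span_singleton.1 hw
  simp [h]

theorem mem_sperp_sup_span : v ∈ sperp B (W ⊔ F ∙ u) ↔ v ∈ sperp B W ∧ B u v = 0 := by
  rw [sperp_sup, Submodule.mem_inf, mem_sperp_span_singleton]

theorem mem_sup_span_exchange (hv : v ∉ W) (h : v ∈ W ⊔ F ∙ u) : u ∈ W ⊔ F ∙ v := by
  obtain ⟨w, hw, a, rfl⟩ := mem_sup_span.1 h
  have ha : a ≠ 0 := by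
    rintro rfl
    simp [hw] at hv
  exact mem_sup_span.2 ⟨-a⁻¹ • w, W.smul_mem _ hw, a⁻¹, by
    rw [smul_add, smul_smul, inv_mul_cancel₀ ha]; simp⟩

variable (B) in
/-- A subspace all of whose vectors are singular (in the sense of `Z`) and pairwise orthogonal. -/
def IsTotallySingular (Z : V → Prop) (W : Submodule F V) : Prop :=
  (∀ v ∈ W, Z v) ∧ ∀ v ∈ W, ∀ w ∈ W, B v w = 0

variable [Fintype F] [Fintype V]

open scoped Classical in
variable (B) in
/-- The common features of the forms defining the polar spaces `P'_{r,e}`: here `Z` is the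
set of singular vectors, and `E = q ^ (e - 1)`. -/
structure IsPolarForm (Z : V → Prop) (r : ℕ) (E : ℝ) : Prop where
  nondeg : ∀ v, (∀ w, B v w = 0) → v = 0
  symm : ∀ v w, B v w = 0 → B w v = 0
  zero : Z 0
  smul : ∀ (a : F) v, Z v → Z (a • v)
  add : ∀ v w, Z v → Z w → B v w = 0 → Z (v + w)
  self : ∀ v, Z v → B v v = 0
  coset : ∀ u v, Z u → B u v ≠ 0 → (#{a : F | Z (v + a • u)} : ℝ) * E = Fintype.card F
  card : (Fintype.card V : ℝ) = E ^ 2 * (Fintype.card F : ℝ) ^ (2 * r)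
  pos : 0 < E
  rank_exists : ∃ W, IsTotallySingular B Z W ∧ finrank F W = r
  rank_le : ∀ W, IsTotallySingular B Z W → finrank F W ≤ r

namespace IsPolarForm

variable {Z : V → Prop} {r : ℕ} {E : ℝ}

theorem isTotallySingular_sup_span (h : IsPolarForm B Z r E)
    (hW : IsTotallySingular B Z W) (hu : u ∈ sperp B W)
    (hZ : Z u) : IsTotallySingular B Z (W ⊔ F ∙ u) := by
  constructor
  · intro v hv
    obtain ⟨w, hw, a, rfl⟩ := mem_sup_span.1 hv
    exact h.add _ _ (hW.1 w hw) (h.smul _ _ hZ) (by simp [hu w hw])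
  · intro v hv v' hv'
    obtain ⟨w, hw, a, rfl⟩ := mem_sup_span.1 hv
    obtain ⟨w', hw', a', rfl⟩ := mem_sup_span.1 hv'
    simp [hu w hw, h.symm _ _ (hu w' hw'), hW.2 w hw w' hw', h.self u hZ]

theorem finrank_sperp (h : IsPolarForm B Z r E)
    (W : Submodule F V) : finrank F (sperp B W) + finrank F W = finrank F V := by
  classical
  have hinj : Function.Injective B.flip := by
    refine (injective_iff_map_eq_zero B.flip.toAddMonoidHom).2 fun v hv => ?_
    refine h.nondeg v fun w => h.symm _ _ ?_
    exact LinearMap.congr_fun (f := B.flip v) (g := 0) hv w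
  have hfin : Finite (Dual F V) := Module.finite_of_finite F
  have := Fintype.ofFinite (Dual F V)
  have hbij : Function.Bijective B.flip := by
    refine (Fintype.bijective_iff_injective_and_card _).2 ⟨hinj, ?_⟩
    rw [card_eq_pow_finrank (K := F) (V := V), card_eq_pow_finrank (K := F) (V := Dual F V),
      Subspace.dual_finrank_eq]
  have hcard : Nat.card (sperp B W) = Nat.card W.dualAnnihilator := by
    refine Nat.card_congr ((Equiv.ofBijective _ hbij).subtypeEquiv fun v => ?_)
    simp [mem_sperp, Submodule.mem_dualAnnihilator]
  rw [natCard_eq_pow_finrank (K := F) (V := sperp B W),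
    natCard_eq_pow_finrank (K := F) (V := W.dualAnnihilator), Nat.card_eq_fintype_card] at hcard
  have := Nat.pow_right_injective (Fintype.one_lt_card (α := F)) hcard
  rw [this, add_comm, Subspace.finrank_add_finrank_dualAnnihilator_eq]

theorem sperp_sperp (h : IsPolarForm B Z r E) (W : Submodule F V) : sperp B (sperp B W) = W := by
  refine (Submodule.eq_of_le_of_finrank_eq ?_ ?_).symm
  · exact fun w hw v hv => h.symm _ _ (hv w hw)
  have := h.finrank_sperp W
  have := h.finrank_sperp (sperp B W)
  omega

theorem exists_extension (h : IsPolarForm B Z r E) (hr : finrank F W < r) :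
    ∃ u, Z u ∧ u ∈ sperp B W ∧ u ∉ W := by
  obtain ⟨G, hG, hGr⟩ := h.rank_exists
  by_contra! hc
  have hle : G ⊓ sperp B W ≤ sperp B G ⊓ W := fun u hu =>
    ⟨fun w hw => hG.2 w hw u hu.1, hc u (hG.1 u hu.1) hu.2⟩
  have h₁ := h.finrank_sperp (sperp B G ⊔ W)
  rw [sperp_sup, h.sperp_sperp] at h₁
  have h₂ := Submodule.finrank_mono hle
  have h₃ := Submodule.finrank_sup_add_finrank_inf_eq (sperp B G) W
  have h₄ := h.finrank_sperp G
  omega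

open scoped Classical in
theorem card_sperp (h : IsPolarForm B Z r E)
    (W : Submodule F V) {s : ℕ} (hs : finrank F W + s = r) :
    (#{v | v ∈ sperp B W} : ℝ) = E ^ 2 * (Fintype.card F : ℝ) ^ (r + s) := by
  have hq : (0 : ℝ) < Fintype.card F := by exact_mod_cast Fintype.card_pos
  rw [card_filter_mem]
  have h₁ := h.card
  rw [card_eq_pow_finrank (K := F) (V := V), ← h.finrank_sperp W] at h₁
  push_cast at h₁ ⊢
  have h₂ : 2 * r = (r + s) + finrank F W := by omega
  rw [h₂, pow_add, pow_add _ (r + s), ← mul_assoc] at h₁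
  exact mul_right_cancel₀ (pow_pos hq _).ne' h₁

open scoped Classical in
/-- If `u ∈ W^⊥` is singular, the proportion of singular vectors in `W^⊥ ∖ u^⊥` is `1 / E`. -/
theorem card_singular_not_orthogonal (h : IsPolarForm B Z r E) (hu : Z u) (hW : u ∈ sperp B W) :
    (#{v | v ∈ sperp B W ∧ B u v ≠ 0 ∧ Z v} : ℝ) * E = #{v | v ∈ sperp B W ∧ B u v ≠ 0} := by
  have hq : (0 : ℝ) < Fintype.card F := by exact_mod_cast Fintype.card_pos
  set D : Finset V := {v | v ∈ sperp B W ∧ B u v ≠ 0} with hD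
  have hmem (a : F) (v : V) : v + a • u ∈ D ↔ v ∈ D := by
    have := (sperp B W).add_mem_iff_left (x := v) ((sperp B W).smul_mem a hW)
    simp [hD, this, h.self u hu]
  have hcount : ∑ v ∈ D, #{a : F | Z (v + a • u)} = Fintype.card F * #{v ∈ D | Z v} := by
    simp_rw [card_filter (fun a : F => Z (_ + a • u))]
    rw [sum_comm, ← card_univ, ← smul_eq_mul, ← sum_const]
    refine sum_congr rfl fun a _ => ?_
    rw [card_filter]
    exact sum_bij' (fun v _ => v + a • u) (fun v _ => v - a • u)
      (fun v hv => (hmem a v).2 hv)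
      (fun v hv => (hmem a _).1 (by simpa using hv)) (by simp) (by simp) (by simp)
  have hfil : ({v | v ∈ sperp B W ∧ B u v ≠ 0 ∧ Z v} : Finset V) = {v ∈ D | Z v} := by
    ext; simp [hD, and_assoc]
  rw [hfil]
  have hsum : (∑ v ∈ D, #{a : F | Z (v + a • u)} : ℝ) * E = ∑ v ∈ D, (Fintype.card F : ℝ) := by
    rw [sum_mul]
    exact sum_congr rfl fun v hv => h.coset u v hu (by simp [hD] at hv; exact hv.2)
  rw [show (∑ v ∈ D, #{a : F | Z (v + a • u)} : ℝ) = Fintype.card F * #{v ∈ D | Z v} by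
    exact_mod_cast hcount, sum_const, nsmul_eq_mul] at hsum
  refine mul_left_cancel₀ hq.ne' ?_
  linarith

open scoped Classical in
/-- The number of singular vectors orthogonal to a totally singular subspace. -/
theorem card_singular_sperp (h : IsPolarForm B Z r E)
    {s : ℕ} (hW : IsTotallySingular B Z W) (hs : finrank F W + s = r) :
    (#{v | v ∈ sperp B W ∧ Z v} : ℝ) = (Fintype.card F : ℝ) ^ r +
      E * (Fintype.card F : ℝ) ^ r * ((Fintype.card F : ℝ) ^ s - 1) := by
  have hq : (0 : ℝ) < Fintype.card F := by exact_mod_cast Fintype.card_pos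
  induction s generalizing W with
  | zero =>
    have : ({v | v ∈ sperp B W ∧ Z v} : Finset V) = ({v | v ∈ W} : Finset V) := by
      ext v
      simp only [mem_filter, mem_univ, true_and]
      refine ⟨fun hv => ?_, fun hv => ⟨fun w hw => hW.2 w hw v hv, hW.1 v hv⟩⟩
      by_contra hvW
      have := h.rank_le _ (h.isTotallySingular_sup_span hW hv.1 hv.2)
      rw [Submodule.finrank_sup_span_singleton hvW] at this
      omega
    rw [this, card_filter_mem]
    simp [← hs]
  | succ s ih =>
    obtain ⟨u, hZ, hu, huW⟩ := h.exists_extension (W := W) (by omega)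
    have hfin : finrank F (W ⊔ F ∙ u : Submodule F V) + s = r := by
      rw [Submodule.finrank_sup_span_singleton huW]; omega
    have h₁ := ih (h.isTotallySingular_sup_span hW hu hZ) hfin
    have h₂ := h.card_sperp _ hfin
    have h₃ := h.card_sperp _ hs
    have h₄ := h.card_singular_not_orthogonal hZ hu
    have h₅ := card_filter_add_card_filter_not (s := ({v | v ∈ sperp B W} : Finset V))
      (fun v => B u v = 0)
    have h₆ := card_filter_add_card_filter_not (s := ({v | v ∈ sperp B W ∧ Z v} : Finset V))
      (fun v => B u v = 0)
    simp only [filter_filter] at h₅ h₆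
    simp only [mem_sperp_sup_span] at h₁ h₂
    simp only [and_assoc, and_comm (a := Z _)] at h₁ h₆
    rw [← h₆]
    rw [← h₅] at h₃
    push_cast at h₃ ⊢
    rw [h₁]
    have h₇ : (#{v | v ∈ sperp B W ∧ B u v ≠ 0 ∧ Z v} : ℝ) =
        E * ((Fintype.card F : ℝ) ^ (r + (s + 1)) - (Fintype.card F : ℝ) ^ (r + s)) := by
      refine mul_right_cancel₀ h.pos.ne' ?_
      rw [h₄]
      rw [h₂] at h₃
      simp only [ne_eq]
      linear_combination h₃
    simp only [ne_eq] at h₇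
    rw [h₇]
    ring

open scoped Classical in
theorem card_orthogonal_not_mem_sup_span (h : IsPolarForm B Z r E)
    {s : ℕ} (hW : IsTotallySingular B Z W)
    (hs : finrank F W + (s + 1) = r) (hv : v ∈ sperp B W) (hvW : v ∉ W) (hZ : Z v) :
    (#{u | u ∈ sperp B W ∧ u ∉ W ∧ Z u ∧ B u v = 0 ∧ v ∉ W ⊔ F ∙ u} : ℝ) =
      (E * (Fintype.card F : ℝ) ^ s + 1) *
        ((Fintype.card F : ℝ) ^ r - (Fintype.card F : ℝ) ^ (finrank F W + 1)) := by
  have hU := h.isTotallySingular_sup_span hW hv hZ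
  have hfin := Submodule.finrank_sup_span_singleton hvW
  have h₁ := h.card_singular_sperp hU (s := s) (by omega)
  have h₂ := card_filter_add_card_filter_not
    (s := ({u | u ∈ sperp B (W ⊔ F ∙ v) ∧ Z u} : Finset V)) (fun u => u ∈ W ⊔ F ∙ v)
  rw [filter_filter, filter_filter] at h₂
  have h₃ : ({u | (u ∈ sperp B (W ⊔ F ∙ v) ∧ Z u) ∧ u ∈ W ⊔ F ∙ v} : Finset V) =
      ({u | u ∈ W ⊔ F ∙ v} : Finset V) := by
    ext u
    simp only [mem_filter, mem_univ, true_and, and_iff_right_iff_imp]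
    exact fun hu => ⟨fun w hw => hU.2 w hw u hu, hU.1 u hu⟩
  have h₄ : ({u | u ∈ sperp B W ∧ u ∉ W ∧ Z u ∧ B u v = 0 ∧ v ∉ W ⊔ F ∙ u} : Finset V) =
      ({u | (u ∈ sperp B (W ⊔ F ∙ v) ∧ Z u) ∧ u ∉ W ⊔ F ∙ v} : Finset V) := by
    ext u
    simp only [mem_filter, mem_univ, true_and, mem_sperp_sup_span]
    constructor
    · rintro ⟨hu, huW, huZ, huv, hn⟩
      exact ⟨⟨⟨hu, h.symm _ _ huv⟩, huZ⟩, fun hc => hn (mem_sup_span_exchange huW hc)⟩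
    · rintro ⟨⟨⟨hu, huv⟩, huZ⟩, hn⟩
      exact ⟨hu, fun hc => hn (Submodule.mem_sup_left hc), huZ, h.symm _ _ huv,
        fun hc => hn (mem_sup_span_exchange hvW hc)⟩
  rw [h₄]
  rw [h₃, card_filter_mem, hfin] at h₂
  have h₅ : ((Fintype.card F : ℝ)) ^ r =
      (Fintype.card F : ℝ) ^ (finrank F W + 1) * (Fintype.card F : ℝ) ^ s := by
    rw [← pow_add, ← hs]; ring
  rw [← h₂] at h₁
  push_cast at h₁
  linear_combination h₁ - E * h₅

open scoped Classical in
theorem card_mem_sup_span (h : IsPolarForm B Z r E) (hW : IsTotallySingular B Z W)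
    (hv : v ∈ sperp B W) (hvW : v ∉ W) (hZ : Z v) :
    (#{u | u ∈ sperp B W ∧ u ∉ W ∧ Z u ∧ v ∈ W ⊔ F ∙ u} : ℝ) =
      (Fintype.card F : ℝ) ^ (finrank F W + 1) - (Fintype.card F : ℝ) ^ finrank F W := by
  have hU := h.isTotallySingular_sup_span hW hv hZ
  have hfin := Submodule.finrank_sup_span_singleton hvW
  have h₂ := card_filter_add_card_filter_not
    (s := ({u | u ∈ W ⊔ F ∙ v} : Finset V)) (fun u => u ∈ W)
  rw [filter_filter, filter_filter, card_filter_mem, hfin] at h₂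
  have h₃ : ({u | u ∈ W ⊔ F ∙ v ∧ u ∈ W} : Finset V) = ({u | u ∈ W} : Finset V) := by
    ext u
    simp only [mem_filter, mem_univ, true_and, and_iff_right_iff_imp]
    exact fun hu => Submodule.mem_sup_left hu
  have h₄ : ({u | u ∈ sperp B W ∧ u ∉ W ∧ Z u ∧ v ∈ W ⊔ F ∙ u} : Finset V) =
      ({u | u ∈ W ⊔ F ∙ v ∧ u ∉ W} : Finset V) := by
    ext u
    simp only [mem_filter, mem_univ, true_and]
    constructor
    · rintro ⟨hu, huW, huZ, hn⟩
      exact ⟨mem_sup_span_exchange hvW hn, huW⟩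
    · rintro ⟨hu, huW⟩
      exact ⟨fun w hw => hU.2 w (Submodule.mem_sup_left hw) u hu, huW, hU.1 u hu,
        mem_sup_span_exchange huW hu⟩
  rw [h₄, eq_sub_iff_add_eq']
  rw [h₃, card_filter_mem] at h₂
  exact_mod_cast h₂

open scoped Classical in
theorem card_singular_sperp_not_mem (h : IsPolarForm B Z r E) {s : ℕ} (hW : IsTotallySingular B Z W)
    (hs : finrank F W + s = r) :
    (#{u | u ∈ sperp B W ∧ u ∉ W ∧ Z u} : ℝ) =
      (E * (Fintype.card F : ℝ) ^ s + 1) *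
        ((Fintype.card F : ℝ) ^ r - (Fintype.card F : ℝ) ^ finrank F W) := by
  have h₁ := h.card_singular_sperp hW hs
  have h₂ := card_filter_add_card_filter_not
    (s := ({u | u ∈ sperp B W ∧ Z u} : Finset V)) (fun u => u ∈ W)
  rw [filter_filter, filter_filter] at h₂
  have h₃ : ({u | (u ∈ sperp B W ∧ Z u) ∧ u ∈ W} : Finset V) = ({u | u ∈ W} : Finset V) := by
    ext u
    simp only [mem_filter, mem_univ, true_and, and_iff_right_iff_imp]
    exact fun hu => ⟨fun w hw => hW.2 w hw u hu, hW.1 u hu⟩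
  rw [h₃, card_filter_mem] at h₂
  simp only [and_assoc, and_comm (a := Z _)] at h₂
  have h₅ : ((Fintype.card F : ℝ)) ^ r =
      (Fintype.card F : ℝ) ^ finrank F W * (Fintype.card F : ℝ) ^ s := by
    rw [← pow_add, ← hs]
  rw [← h₂] at h₁
  push_cast at h₁
  linear_combination h₁ - E * h₅

open scoped Classical in
/-- If a function supported on singular vectors has constant sum `M` over all maximal totally
singular subspaces, then its sum over `W^⊥ ∖ W` is determined by its sum over `W`. -/
theorem sum_sperp_not_mem (h : IsPolarForm B Z r E) {f : V → ℝ} {M : ℝ} (hf : ∀ v, ¬ Z v → f v = 0)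
    (hM : ∀ G, IsTotallySingular B Z G → finrank F G = r → ∑ v with v ∈ G, f v = M) {s : ℕ}
    (hW : IsTotallySingular B Z W) (hs : finrank F W + s = r) :
    ∑ v with v ∈ sperp B W ∧ v ∉ W, f v =
      (M - ∑ v with v ∈ W, f v) * (E * (Fintype.card F : ℝ) ^ s + 1) := by
  have hq : (1 : ℝ) < Fintype.card F := by exact_mod_cast Fintype.one_lt_card
  induction s generalizing W with
  | zero =>
    rw [hM W hW (by omega), sub_self, zero_mul]
    refine sum_eq_zero fun v hv => hf v fun hZ => ?_
    simp only [mem_filter, mem_univ, true_and] at hv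
    have := h.rank_le _ (h.isTotallySingular_sup_span hW hv.1 hZ)
    rw [Submodule.finrank_sup_span_singleton hv.2] at this
    omega
  | succ s ih =>
    set T : Finset V := {u | u ∈ sperp B W ∧ u ∉ W ∧ Z u} with hT
    have hmem {u : V} : u ∈ T ↔ u ∈ sperp B W ∧ u ∉ W ∧ Z u := by simp [hT]
    have hX : ∑ v with v ∈ sperp B W ∧ v ∉ W, f v = ∑ v ∈ T, f v := by
      symm
      refine sum_subset (fun v hv => ?_) fun v hv hv' => hf v fun hZ => hv' ?_
      · simp only [mem_filter, mem_univ, true_and]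
        exact ⟨(hmem.1 hv).1, (hmem.1 hv).2.1⟩
      · simp only [mem_filter, mem_univ, true_and] at hv
        exact hmem.2 ⟨hv.1, hv.2, hZ⟩
    have hperp (u : V) : ∑ v with v ∈ sperp B (W ⊔ F ∙ u) ∧ v ∉ W ⊔ F ∙ u, f v =
        ∑ v ∈ T, if B u v = 0 ∧ v ∉ W ⊔ F ∙ u then f v else 0 := by
      rw [← sum_filter]
      symm
      refine sum_subset (fun v hv => ?_) fun v hv hv' => hf v fun hZ => hv' ?_
      · rw [mem_filter, hmem] at hv
        simp only [mem_filter, mem_univ, true_and, mem_sperp_sup_span]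
        exact ⟨⟨hv.1.1, hv.2.1⟩, hv.2.2⟩
      · simp only [mem_filter, mem_univ, true_and, mem_sperp_sup_span] at hv
        rw [mem_filter, hmem]
        exact ⟨⟨hv.1.1, fun hc => hv.2 (Submodule.mem_sup_left hc), hZ⟩, hv.1.2, hv.2⟩
    have hspan {u : V} (hu : u ∈ T) : ∑ v with v ∈ W ⊔ F ∙ u, f v =
        ∑ v with v ∈ W, f v + ∑ v ∈ T, if v ∈ W ⊔ F ∙ u then f v else 0 := by
      have hU := h.isTotallySingular_sup_span hW (hmem.1 hu).1 (hmem.1 hu).2.2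
      rw [← sum_filter, ← sum_filter_add_sum_filter_not ({v | v ∈ W ⊔ F ∙ u} : Finset V)
        (fun v => v ∈ W), filter_filter, filter_filter]
      congr 2
      · ext v
        simp only [mem_filter, mem_univ, true_and, and_iff_right_iff_imp]
        exact fun hv => Submodule.mem_sup_left hv
      · ext v
        simp only [mem_filter, mem_univ, true_and, hmem]
        refine ⟨fun hv => ⟨⟨fun w hw => ?_, hv.2, hU.1 v hv.1⟩, hv.1⟩,
          fun hv => ⟨hv.2, hv.1.2.1⟩⟩
        exact hU.2 w (Submodule.mem_sup_left hw) v hv.1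
    have hswap (R : V → V → Prop) (c : ℝ) (hR : ∀ v ∈ T, (#{u ∈ T | R u v} : ℝ) = c) :
        (∑ u ∈ T, ∑ v ∈ T, if R u v then f v else 0) = c * ∑ v ∈ T, f v := by
      rw [sum_comm, mul_sum]
      refine sum_congr rfl fun v hv => ?_
      rw [← sum_filter, sum_const, nsmul_eq_mul, hR v hv]
    have h₁ : (∑ u ∈ T, ∑ v ∈ T, if B u v = 0 ∧ v ∉ W ⊔ F ∙ u then f v else 0) =
        (E * (Fintype.card F : ℝ) ^ s + 1) * ((Fintype.card F : ℝ) ^ r -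
          (Fintype.card F : ℝ) ^ (finrank F W + 1)) * ∑ v ∈ T, f v := by
      convert hswap (fun u v => B u v = 0 ∧ v ∉ W ⊔ F ∙ u) _ fun v hv => ?_
      rw [hT, filter_filter]
      simp only [and_assoc]
      exact h.card_orthogonal_not_mem_sup_span hW hs (hmem.1 hv).1 (hmem.1 hv).2.1 (hmem.1 hv).2.2
    have h₂ := hswap (fun u v => v ∈ W ⊔ F ∙ u) _ fun v hv => by
      rw [hT, filter_filter]
      simp only [and_assoc]
      exact h.card_mem_sup_span hW (hmem.1 hv).1 (hmem.1 hv).2.1 (hmem.1 hv).2.2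
    have h₃ := h.card_singular_sperp_not_mem hW hs
    rw [← hT] at h₃
    have h₄ : ∑ u ∈ T, (∑ v ∈ T, if B u v = 0 ∧ v ∉ W ⊔ F ∙ u then f v else 0) =
        ∑ u ∈ T, (M - (∑ v with v ∈ W, f v + ∑ v ∈ T, if v ∈ W ⊔ F ∙ u then f v else 0)) *
          (E * (Fintype.card F : ℝ) ^ s + 1) := by
      refine sum_congr rfl fun u hu => ?_
      rw [← hperp, ← hspan hu]
      refine ih (h.isTotallySingular_sup_span hW (hmem.1 hu).1 (hmem.1 hu).2.2) ?_
      rw [Submodule.finrank_sup_span_singleton (hmem.1 hu).2.1]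
      omega
    rw [h₁, ← sum_mul, sum_sub_distrib, sum_add_distrib, sum_const, sum_const, h₂, nsmul_eq_mul,
      nsmul_eq_mul, h₃] at h₄
    rw [hX]
    have h₅ : (0 : ℝ) < E * (Fintype.card F : ℝ) ^ s + 1 := by
      have := h.pos
      positivity
    have h₆ : (0 : ℝ) < (Fintype.card F : ℝ) ^ r - (Fintype.card F : ℝ) ^ finrank F W :=
      sub_pos.2 (pow_lt_pow_right₀ hq (by omega))
    refine mul_left_cancel₀ (mul_pos h₅ h₆).ne' ?_
    linear_combination h₄

end IsPolarForm

end Counting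
section Hermitian

open Finset

variable {F : Type} [Field F] [Fintype F] {σ : F →+* F}

open scoped Classical in
/-- For an involution `σ ≠ id` of a finite field, the trace `x ↦ x + σ x` takes every value
fixed by `σ` equally often, namely as many times as there are fixed elements. -/
theorem card_add_map_eq (hσ : σ ≠ RingHom.id F) (hσσ : σ.comp σ = RingHom.id F) {t : F}
    (ht : σ t = t) : #{x : F | x + σ x = t} ^ 2 = Fintype.card F := by
  have hinv (x : F) : σ (σ x) = x := DFunLike.congr_fun hσσ x
  obtain ⟨y, hy⟩ : ∃ y, σ y ≠ y := by
    by_contra! hc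
    exact hσ (RingHom.ext hc)
  set K : Finset F := {x | σ x = x} with hK
  have memK {x : F} : x ∈ K ↔ σ x = x := by simp [hK]
  have hfib (z : F) (hz : ∃ x, x + σ x = z) : #{x : F | x + σ x = z} = #K := by
    obtain ⟨x₀, rfl⟩ := hz
    have hδ : y - σ y ≠ 0 := sub_ne_zero.2 (Ne.symm hy)
    refine card_bij' (fun x _ => (x - x₀) / (y - σ y)) (fun x _ => x * (y - σ y) + x₀)
      (fun x hx => ?_) (fun x hx => ?_) (fun x hx => ?_) (fun x hx => ?_)
    · simp only [mem_filter, mem_univ, true_and] at hx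
      rw [memK, map_div₀, map_sub, map_sub, hinv, ← neg_sub y (σ y), div_neg, ← neg_div]
      congr 1
      linear_combination -hx
    · rw [memK] at hx
      simp only [mem_filter, mem_univ, true_and, map_add, map_mul, map_sub, hinv, hx]
      ring
    · field_simp; ring
    · field_simp; ring
  have hmaps : Set.MapsTo (fun x : F => x + σ x) (univ : Finset F) K := by
    intro x _
    simp [hK, hinv, add_comm]
  have hle (z : F) : #{x : F | x + σ x = z} ≤ #K := by
    by_cases hz : ∃ x, x + σ x = z
    · exact (hfib z hz).le
    · rw [filter_false_of_mem fun x _ hx => hz ⟨x, hx⟩]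
      simp
  have hcard := card_eq_sum_card_fiberwise hmaps
  have hsq : #K * #K ≤ Fintype.card F := by
    rw [← card_product, ← card_univ]
    refine card_le_card_of_injOn (fun p => p.1 + p.2 * y) (fun _ _ => mem_coe.2 (mem_univ _)) ?_
    rintro ⟨a, b⟩ hab ⟨a', b'⟩ hab' he
    simp only [coe_product, Set.mem_prod, mem_coe, memK] at hab hab' he
    have hb : b = b' := by
      by_contra hne
      have he' := congrArg σ he
      simp only [map_add, map_mul, hab.1, hab.2, hab'.1, hab'.2] at he'
      refine hy (mul_left_cancel₀ (sub_ne_zero.2 hne) ?_)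
      linear_combination he' - he
    subst hb
    simpa using he
  have heq : ∑ z ∈ K, #{x : F | x + σ x = z} = ∑ _z ∈ K, #K := by
    refine le_antisymm (sum_le_sum fun z _ => hle z) ?_
    rw [← hcard, sum_const, smul_eq_mul, card_univ]
    exact hsq
  have hall := (sum_eq_sum_iff_of_le fun z _ => hle z).1 heq
  rw [hall t (memK.2 ht), ← card_univ, hcard, heq, sum_const, smul_eq_mul, sq]

end Hermitian

section Projective

open Finset

variable {F V : Type} [Field F] [AddCommGroup V] [Module F V]

open scoped Classical in
/-- The function on vectors induced by a function on projective points, with value `0` at `0`. -/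
def vecFun (g : Projectivization F V → ℝ) (v : V) : ℝ :=
  if h : v = 0 then 0 else g (Projectivization.mk F v h)

theorem rep_mk_mem_iff {W : Submodule F V} {v : V} (hv : v ≠ 0) :
    (Projectivization.mk F v hv).rep ∈ W ↔ v ∈ W := by
  obtain ⟨a, ha⟩ := Projectivization.exists_smul_eq_mk_rep F v hv
  rw [← ha]
  exact W.smul_mem_iff_of_isUnit a.isUnit

theorem mk_smul_rep (p : Projectivization F V) {a : F} (h : a • p.rep ≠ 0) :
    Projectivization.mk F (a • p.rep) h = p := by
  conv_rhs => rw [← p.mk_rep]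
  exact (Projectivization.mk_eq_mk_iff' F _ _ h p.rep_nonzero).2 ⟨a, rfl⟩

theorem sum_vecFun [Fintype F] [Fintype V] [Fintype (Projectivization F V)]
    (g : Projectivization F V → ℝ) :
    ∑ v, vecFun g v = (Fintype.card F - 1 : ℝ) * ∑ p, g p := by
  classical
  have h₁ : ∑ v, vecFun g v = ∑ v with v ≠ 0, vecFun g v := by
    symm
    refine sum_subset (subset_univ _) fun v _ hv => ?_
    simp only [ne_eq, mem_filter, mem_univ, true_and, not_not] at hv
    simp [vecFun, hv]
  have h₂ : ((Fintype.card F - 1 : ℝ)) = #{a : F | a ≠ 0} := by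
    rw [filter_ne', card_erase_of_mem (mem_univ _), card_univ, Nat.cast_sub Fintype.card_pos]
    simp
  rw [h₁, h₂, ← nsmul_eq_mul, ← sum_const, ← sum_product']
  symm
  have hne (x : F × Projectivization F V) (hx : x.1 ≠ 0) : x.1 • x.2.rep ≠ 0 :=
    smul_ne_zero hx x.2.rep_nonzero
  refine sum_bij (fun x _ => x.1 • x.2.rep) (fun x hx => ?_) (fun x hx y hy he => ?_)
    (fun v hv => ?_) (fun x hx => ?_)
  · simp only [mem_product, mem_filter, mem_univ, true_and, and_true] at hx ⊢
    exact hne x hx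
  · simp only [mem_product, mem_filter, mem_univ, true_and, and_true] at hx hy
    have h₃ : x.2 = y.2 := by
      rw [← mk_smul_rep x.2 (hne x hx), ← mk_smul_rep y.2 (hne y hy)]
      congr 1
    rw [h₃] at he
    exact Prod.ext (smul_left_injective F y.2.rep_nonzero he) h₃
  · simp only [mem_filter, mem_univ, true_and] at hv
    obtain ⟨a, ha⟩ := Projectivization.exists_smul_eq_mk_rep F v hv
    refine ⟨(a⁻¹.1, Projectivization.mk F v hv), by simp, ?_⟩
    rw [← ha, Units.smul_def, smul_smul]
    simp
  · simp only [mem_product, mem_filter, mem_univ, true_and, and_true] at hx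
    rw [vecFun, dif_neg (hne x hx), mk_smul_rep]

/-- Summing over a set of vectors that is the cone over the set `S` of projective points. -/
theorem sum_filter_vecFun [Fintype F] [Fintype V] {S : Set (Projectivization F V)} {C : V → Prop}
    [DecidablePred C] (hC : ∀ v (hv : v ≠ 0), C v ↔ Projectivization.mk F v hv ∈ S)
    (g : Projectivization F V → ℝ) :
    ∑ v with C v, vecFun g v = (Fintype.card F - 1 : ℝ) * ∑ᶠ p ∈ S, g p := by
  classical
  have := Fintype.ofFinite (Projectivization F V)
  rw [finsum_mem_def, finsum_eq_sum_of_fintype, ← sum_vecFun, sum_filter]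
  refine sum_congr rfl fun v _ => ?_
  by_cases hv : v = 0
  · simp [vecFun, hv]
  · simp [vecFun, hv, Set.indicator_apply, hC v hv]

end Projective

section Spec

open Finset Module

variable {F : Type} [Field F] [Fintype F] {r : ℕ} {k : PolarKind}

/-- The number `q ^ (e - 1)`. -/
def PolarKind.factor (k : PolarKind) (q : ℕ) : ℝ := (q : ℝ) ^ (k.e - 1)

theorem PolarKind.card_eq (k : PolarKind) (r : ℕ) :
    (Fintype.card (Fin (k.vdim r) → F) : ℝ) =
      k.factor (Fintype.card F) ^ 2 * (Fintype.card F : ℝ) ^ (2 * r) := by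
  have hq : (0 : ℝ) < Fintype.card F := by exact_mod_cast Fintype.card_pos
  have h : ((k.factor (Fintype.card F)) ^ 2 * (Fintype.card F : ℝ) ^ (2 * r)) =
      (Fintype.card F : ℝ) ^ ((k.e - 1) * 2 + (2 * r : ℕ)) := by
    rw [Real.rpow_add hq, Real.rpow_mul hq.le, Real.rpow_natCast]
    simp [PolarKind.factor]
  rw [h, Fintype.card_fun, Fintype.card_fin]
  push_cast
  rw [← Real.rpow_natCast]
  congr 1
  cases k <;> simp [PolarKind.vdim, PolarKind.e] <;> ring

/-- Every polar space `P'_{r,e}` is given by a form with the uniform combinatorial properties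
of `IsPolarForm`. -/
theorem PolarSpace.exists_isPolarForm (P : PolarSpace F r k) :
    ∃ Z : (Fin (k.vdim r) → F) → Prop, IsPolarForm P.B Z r (k.factor (Fintype.card F)) ∧
      (∀ W, P.ti W ↔ IsTotallySingular P.B Z W) ∧ P.sing = {p | Z p.rep} := by
  classical
  obtain ⟨σ, B, nondeg, sing, ti, spec, rank_exists, rank_le⟩ := P
  have hq : (0 : ℝ) < Fintype.card F := by exact_mod_cast Fintype.card_pos
  have hcard := k.card_eq (F := F) r
  have hpos : 0 < k.factor (Fintype.card F) := Real.rpow_pos_of_pos hq _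
  dsimp only
  suffices h : ∃ Z : (Fin (k.vdim r) → F) → Prop, (∀ v w, B v w = 0 → B w v = 0) ∧ Z 0 ∧
      (∀ (a : F) v, Z v → Z (a • v)) ∧ (∀ v w, Z v → Z w → B v w = 0 → Z (v + w)) ∧
      (∀ v, Z v → B v v = 0) ∧
      (∀ u v, Z u → B u v ≠ 0 →
        (#{a : F | Z (v + a • u)} : ℝ) * k.factor (Fintype.card F) = Fintype.card F) ∧
      (∀ W, ti W ↔ IsTotallySingular B Z W) ∧ sing = {p | Z p.rep} by
    obtain ⟨Z, symm, zero, smul, add, self, coset, hti, hsing⟩ := h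
    refine ⟨Z, ⟨nondeg, symm, zero, smul, add, self, coset, hcard, hpos, ?_, ?_⟩, hti, hsing⟩
    · simpa only [hti] using rank_exists
    · simpa only [hti] using rank_le
  cases k with
  | symplectic =>
    obtain ⟨rfl, halt, rfl, hti⟩ := spec
    have hskew (v w) : B v w = -B w v := by
      have := halt (v + w)
      simp only [map_add, LinearMap.add_apply, halt] at this
      linear_combination this
    refine ⟨fun _ => True, fun v w h => by rw [hskew, h, neg_zero], trivial, fun _ _ _ => trivial,
      fun _ _ _ _ _ => trivial, fun v _ => halt v, fun u v _ _ => ?_, fun W => ?_, by simp⟩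
    · simp [PolarKind.factor, PolarKind.e]
    · simp [hti, IsTotallySingular]
  | hermitian =>
    obtain ⟨hσ, hσσ, hB, rfl, hti⟩ := spec
    refine ⟨fun v => B v v = 0, fun v w h => by rw [hB, h, map_zero], by simp,
      fun a v h => by simp [h], fun v w hv hw h => by simp [hv, hw, h, hB v w], fun v h => h,
      fun u v hu huv => ?_, fun W => ?_, rfl⟩
    · have hfac : PolarKind.hermitian.factor (Fintype.card F) = √(Fintype.card F) := by
        rw [PolarKind.factor, Real.sqrt_eq_rpow]
        norm_num [PolarKind.e]
      have hσt : σ (-B v v) = -B v v := by rw [map_neg, ← hB]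
      have h₁ := card_add_map_eq hσ hσσ hσt
      have h₂ : #{a : F | B (v + a • u) (v + a • u) = 0} = #{x : F | x + σ x = -B v v} := by
        refine card_bij' (fun a _ => a * B u v) (fun x _ => x / B u v)
          (fun a ha => ?_) (fun x hx => ?_) (fun a _ => by field_simp) (fun x _ => by field_simp)
        · simp only [mem_filter, mem_univ, true_and, map_add, LinearMap.add_apply, map_smul,
            map_smulₛₗ, LinearMap.smul_apply, smul_eq_mul, hu, hB u v, mul_zero, add_zero] at ha ⊢
          rw [map_mul]
          linear_combination ha
        · simp only [mem_filter, mem_univ, true_and, map_add, LinearMap.add_apply, map_smul,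
            map_smulₛₗ, LinearMap.smul_apply, smul_eq_mul, hu, hB u v, mul_zero, add_zero] at hx ⊢
          rw [map_div₀, div_mul_cancel₀ _ huv,
            div_mul_cancel₀ _ ((map_ne_zero σ).2 huv)]
          linear_combination hx
      rw [h₂, hfac, ← h₁]
      push_cast
      rw [Real.sqrt_sq (Nat.cast_nonneg _), sq]
    · rw [hti]
      exact ⟨fun h => ⟨fun v hv => h v hv v hv, h⟩, fun h => h.2⟩
  | elliptic =>
    obtain ⟨rfl, Q, hQ, rfl, hti⟩ := spec
    have hadd (v w) : Q (v + w) = Q v + Q w + B v w := by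
      rw [← hQ, QuadraticMap.polar]; ring
    refine ⟨fun v => Q v = 0, fun v w h => by rw [← hQ, QuadraticMap.polar_comm, hQ, h],
      by simp, fun a v h => by simp [QuadraticMap.map_smul, h],
      fun v w hv hw h => by simp [hadd, hv, hw, h], fun v h => ?_, fun u v hu huv => ?_,
      fun W => ?_, rfl⟩
    · have := hadd v v
      rw [← two_smul F v, QuadraticMap.map_smul, h] at this
      simpa using this.symm
    · have hvu : B v u ≠ 0 := by
        rwa [← hQ, QuadraticMap.polar_comm, hQ]
      have h₁ : #{a : F | Q (v + a • u) = 0} = 1 := by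
        rw [card_eq_one]
        refine ⟨-Q v / B v u, ?_⟩
        ext a
        simp only [mem_filter, mem_univ, true_and, mem_singleton, hadd, QuadraticMap.map_smul,
          map_smul, hu, smul_eq_mul, eq_div_iff hvu]
        constructor <;> intro h <;> linear_combination h
      rw [h₁]
      norm_num [PolarKind.factor, PolarKind.e]
    · rw [hti]
      refine ⟨fun h => ⟨h, fun v hv w hw => ?_⟩, fun h => h.1⟩
      have := hadd v w
      rw [h _ (W.add_mem hv hw), h v hv, h w hw] at this
      simpa using this.symm

theorem nwt_singleton {X : Type} (O : Set X) (p : X) :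
    nwt O {p} = O.indicator (fun _ => 1) p := by
  by_cases hp : p ∈ O <;> simp [nwt, hp]

theorem finsum_mem_nwt_singleton {X : Type} [Finite X] (O S : Set X) :
    ∑ᶠ p ∈ S, nwt O {p} = ((S ∩ O).ncard : ℝ) := by
  simp_rw [nwt_singleton]
  rw [finsum_mem_def, Set.indicator_indicator, ← finsum_mem_def,
    finsum_mem_eq_finite_toFinset_sum _ (Set.toFinite _),
    Set.ncard_eq_toFinset_card _ (Set.toFinite _)]
  simp

end Spec

/-- Lemma 4.1, first part: if `O` is a non-trivial `m`-ovoid of `P'_{r,e}`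
with weight function `μ` and `p₀` is a point of `P'_{r,e}`, then
`Σ_{p ∈ p₀^⊥∖{p₀}} μ(p)² = (m − μ(p₀))·(q^{r+e−2} + 1)`. -/
theorem ovoid_perp_square_sum
    {F : Type} [Field F] [Fintype F] {q r m : ℕ} (hq : Fintype.card F = q)
    {k : PolarKind} (P : PolarSpace F r k)
    (O : Set (Projectivization F (Fin (k.vdim r) → F)))
    (hO : P.IsNontrivialMOvoid m O)
    (p₀ : Projectivization F (Fin (k.vdim r) → F)) (hp₀ : p₀ ∈ P.sing) :
    ∑ᶠ p ∈ pts (P.pperp p₀) \ {p₀}, (nwt O {p}) ^ 2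
      = ((m : ℝ) - nwt O {p₀}) * ((q : ℝ) ^ ((r : ℝ) + k.e - 2) + 1) := by
  classical
  subst hq
  obtain ⟨Z, h, hti, hsing⟩ := P.exists_isPolarForm
  obtain ⟨⟨hOs, hOm⟩, -, -⟩ := hO
  have hq : (1 : ℝ) < Fintype.card F := by exact_mod_cast Fintype.one_lt_card
  have hq' : (Fintype.card F - 1 : ℝ) ≠ 0 := by linarith
  have hZ₀ : Z p₀.rep := by rwa [hsing] at hp₀
  have hne : p₀.rep ≠ 0 := p₀.rep_nonzero
  set W := Submodule.span F {p₀.rep} with hWdef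
  have hW : IsTotallySingular P.B Z W := by
    have := h.isTotallySingular_sup_span (W := ⊥) (u := p₀.rep) ⟨by simp [h.zero], by simp⟩
      (fun w hw => by simp [(Submodule.mem_bot F).1 hw]) hZ₀
    rwa [bot_sup_eq] at this
  have hfin : Module.finrank F W = 1 := finrank_span_singleton hne
  have hr : 1 ≤ r := hfin ▸ h.rank_le _ hW
  have hptsW : pts W = {p₀} := by
    ext p
    rw [Set.mem_singleton_iff, ← Projectivization.mk_rep p, ← Projectivization.mk_rep p₀,
      Projectivization.mk_eq_mk_iff']
    simp [pts, hWdef, Submodule.mem_span_singleton]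
  have hmem (U : Submodule F (Fin (k.vdim r) → F)) (v) (hv : v ≠ 0) :
      v ∈ U ↔ Projectivization.mk F v hv ∈ pts U := (rep_mk_mem_iff hv).symm
  have hf (v) (hv : ¬ Z v) : vecFun (fun p => nwt O {p}) v = 0 := by
    rw [vecFun]
    split_ifs with hv0
    · rfl
    · rw [nwt_singleton, Set.indicator_of_notMem]
      intro hmO
      have hs := hOs hmO
      rw [hsing] at hs
      obtain ⟨a, ha⟩ := Projectivization.exists_smul_eq_mk_rep F v hv0
      refine hv ?_
      have := h.smul (a⁻¹ : Fˣ) _ hs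
      rwa [← ha, Units.smul_def, smul_smul, Units.inv_mul, one_smul] at this
  have key := h.sum_sperp_not_mem hf (M := (Fintype.card F - 1 : ℝ) * m) (s := r - 1)
    (fun G hG hGr => by
      rw [sum_filter_vecFun (hmem G), finsum_mem_nwt_singleton, hOm G ⟨(hti G).2 hG, hGr⟩])
    hW (by omega)
  rw [sum_filter_vecFun (C := fun v => v ∈ sperp P.B W ∧ v ∉ W) (S := pts (P.pperp p₀) \ {p₀}),
    sum_filter_vecFun (hmem W), hptsW,
    finsum_mem_singleton, ← mul_sub, mul_assoc] at key
  · have hexp : (Fintype.card F : ℝ) ^ ((r : ℝ) + k.e - 2) =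
        k.factor (Fintype.card F) * (Fintype.card F : ℝ) ^ (r - 1) := by
      rw [PolarKind.factor, ← Real.rpow_natCast, ← Real.rpow_add (by linarith), Nat.cast_sub hr]
      congr 1
      push_cast
      ring
    have hsq (p) : nwt O {p} ^ 2 = nwt O {p} := by
      rw [nwt_singleton]
      by_cases hp : p ∈ O <;> simp [hp]
    simp_rw [hsq]
    rw [hexp]
    exact mul_left_cancel₀ hq' key
  · intro v hv
    rw [hmem _ v hv, hmem W v hv, hptsW]
    rfl

end PolarOvoids
end
end
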